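/- Let p ≥ 2 and V = pV_2, the direct sum of p copies of V_2, with coordinates (q_1,…,q_p). Then the invariant ring R = O(V)^{SL(2,ℂ)} is generated as a ℂ-algebra by the C(p+1,2) degree-2 invariants (q_i,q_j)_2 for 1 ≤ i ≤ j ≤ p together with the C(p,3) degree-3 invariants (q_i,(q_j,q_k)_1)_2 for 1 ≤ i < j < k ≤ p, and R possesses a homogeneous system of parameters consisting of 3p − 3 invariants of degree 2. -/

import Mathlib

open MvPolynomial

noncomputable section

namespace BinInv

/-- `k`-fold partial derivative with respect to the variable `v`. -/
def pd {A : Type*} [CommSemiring A] (v : Fin 2) (k : ℕ)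
    (f : MvPolynomial (Fin 2) A) : MvPolynomial (Fin 2) A :=
  (fun g => MvPolynomial.pderiv v g)^[k] f

/-- The `p`-th transvectant of binary forms `g`, `h` of degrees `m`, `n`,
with coefficients in a commutative `ℂ`-algebra `A`. -/
def transvectant {A : Type*} [CommRing A] [Algebra ℂ A] (m n p : ℕ)
    (g h : MvPolynomial (Fin 2) A) : MvPolynomial (Fin 2) A :=
  algebraMap ℂ (MvPolynomial (Fin 2) A)
      ((((m - p).factorial * (n - p).factorial : ℕ) : ℂ) /
        (((m.factorial * n.factorial : ℕ)) : ℂ)) *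
    ∑ i ∈ Finset.range (p + 1),
      algebraMap ℂ (MvPolynomial (Fin 2) A) ((-1 : ℂ) ^ i * (p.choose i : ℂ)) *
        (pd 0 (p - i) (pd 1 i g) * pd 0 i (pd 1 (p - i) h))

variable {p : ℕ}

/-- Index type for the coefficients of a system of binary forms of degrees `n 0, …, n (p-1)`:
the space `V = V_{n 0} ⊕ … ⊕ V_{n (p-1)}` is identified with `Idx n → ℂ`. -/
abbrev Idx (n : Fin p → ℕ) : Type := Σ i : Fin p, Fin (n i + 1)

/-- The binary form of degree `n i` with coefficient vector `c`. -/
def formAt (n : Fin p → ℕ) (c : Idx n → ℂ) (i : Fin p) : MvPolynomial (Fin 2) ℂ :=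
  ∑ k : Fin (n i + 1), C (c ⟨i, k⟩) * X 0 ^ (n i - (k : ℕ)) * X 1 ^ (k : ℕ)

/-- The substitution action of `SL(2,ℂ)` on binary forms: `(g • f)(v) = f (g⁻¹ • v)`. -/
def sl2Act (g : Matrix.SpecialLinearGroup (Fin 2) ℂ) (f : MvPolynomial (Fin 2) ℂ) :
    MvPolynomial (Fin 2) ℂ :=
  aeval (fun i => ∑ j, C ((↑(g⁻¹) : Matrix (Fin 2) (Fin 2) ℂ) i j) * X j) f

/-- The coefficient of `x^(n-k) y^k` in a binary form. -/
def coeffAt (n : Fin p → ℕ) (j : Idx n) (f : MvPolynomial (Fin 2) ℂ) : ℂ :=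
  MvPolynomial.coeff
    (Finsupp.single 0 (n j.1 - (j.2 : ℕ)) + Finsupp.single 1 (j.2 : ℕ)) f

/-- The induced action of `SL(2,ℂ)` on points of `V`, in coefficient coordinates. -/
def actPt (n : Fin p → ℕ) (g : Matrix.SpecialLinearGroup (Fin 2) ℂ) (c : Idx n → ℂ) :
    Idx n → ℂ :=
  fun j => coeffAt n j (sl2Act g (formAt n c j.1))

/-- A polynomial function on `V` is invariant if it is constant on `SL(2,ℂ)`-orbits. -/
def IsInvariant (n : Fin p → ℕ) (P : MvPolynomial (Idx n) ℂ) : Prop :=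
  ∀ (g : Matrix.SpecialLinearGroup (Fin 2) ℂ) (c : Idx n → ℂ),
    eval (actPt n g c) P = eval c P

/-- The invariant ring `R = O(V)^{SL(2,ℂ)}` as a subalgebra of `O(V)`. -/
def invariantRing (n : Fin p → ℕ) : Subalgebra ℂ (MvPolynomial (Idx n) ℂ) where
  carrier := {P | IsInvariant n P}
  mul_mem' := fun ha hb g c => by
    simp only [map_mul]; rw [ha g c, hb g c]
  one_mem' := fun g c => by simp
  add_mem' := fun ha hb g c => by
    simp only [map_add]; rw [ha g c, hb g c]
  zero_mem' := fun g c => by simp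
  algebraMap_mem' := fun r g c => by simp

/-- The nullcone: the points of `V` where every homogeneous invariant of positive
degree vanishes. -/
def Nullcone (n : Fin p → ℕ) : Set (Idx n → ℂ) :=
  {c | ∀ P ∈ invariantRing n, ∀ d : ℕ, 0 < d → P.IsHomogeneous d → eval c P = 0}

/-- `P` is a homogeneous system of parameters of the invariant ring, with degrees `d`:
the `P j` are homogeneous invariants of positive degrees `d j`, algebraically independent
over `ℂ`, and the invariant ring is integral over the subalgebra they generate. -/
def IsHSOP (n : Fin p → ℕ) {k : ℕ} (P : Fin k → MvPolynomial (Idx n) ℂ)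
    (d : Fin k → ℕ) : Prop :=
  (∀ j, P j ∈ invariantRing n) ∧ (∀ j, 0 < d j) ∧
    (∀ j, (P j).IsHomogeneous (d j)) ∧ AlgebraicIndependent ℂ P ∧
    ∀ x ∈ invariantRing n, IsIntegral (↥(Algebra.adjoin ℂ (Set.range P))) x

/-- `r` is the minimal number of generators of the invariant ring. -/
def IsMinimalNumGens (n : Fin p → ℕ) (r : ℕ) : Prop :=
  IsLeast {k | ∃ S : Finset (MvPolynomial (Idx n) ℂ),
    S.card = k ∧ Algebra.adjoin ℂ (S : Set (MvPolynomial (Idx n) ℂ)) = invariantRing n} r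

/-- The invariant ring has minimal number of generators `r`, realized by a minimal
system of homogeneous generators of degrees `d 0, …, d (r-1)`. -/
def HasMinimalGens (n : Fin p → ℕ) {r : ℕ} (d : Fin r → ℕ) : Prop :=
  IsMinimalNumGens n r ∧
    ∃ G : Fin r → MvPolynomial (Idx n) ℂ, Function.Injective G ∧
      (∀ j, (G j).IsHomogeneous (d j)) ∧
      Algebra.adjoin ℂ (Set.range G) = invariantRing n

/-- The generic binary form of degree `n i`, whose coefficients are the corresponding
coordinate functions on `V`. -/
def genForm (n : Fin p → ℕ) (i : Fin p) :
    MvPolynomial (Fin 2) (MvPolynomial (Idx n) ℂ) :=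
  ∑ k : Fin (n i + 1), C (X ⟨i, k⟩) * X 0 ^ (n i - (k : ℕ)) * X 1 ^ (k : ℕ)

end BinInv

end

namespace BinInv

noncomputable section

variable {p : ℕ}

/-- The polarised discriminant `2 u₀ v₂ + 2 u₂ v₀ - u₁ v₁` of two binary quadratic forms. -/
def pairing {A : Type*} [CommRing A] (u v : Fin 3 → A) : A :=
  2 * u 0 * v 2 + 2 * u 2 * v 0 - u 1 * v 1

/-- Twice the first transvectant of two binary quadratic forms, on coefficient vectors. -/
def cross {A : Type*} [CommRing A] (u v : Fin 3 → A) : Fin 3 → A :=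
  ![u 0 * v 1 - u 1 * v 0, 2 * (u 0 * v 2 - u 2 * v 0), u 1 * v 2 - u 2 * v 1]

/-- The coefficient vector of the binary quadratic form `q ∘ M`. -/
def subst {A : Type*} [CommRing A] (M : Matrix (Fin 2) (Fin 2) A) (u : Fin 3 → A) : Fin 3 → A :=
  ![u 0 * M 0 0 ^ 2 + u 1 * M 0 0 * M 1 0 + u 2 * M 1 0 ^ 2,
    2 * u 0 * M 0 0 * M 0 1 + u 1 * (M 0 0 * M 1 1 + M 1 0 * M 0 1) + 2 * u 2 * M 1 0 * M 1 1,
    u 0 * M 0 1 ^ 2 + u 1 * M 0 1 * M 1 1 + u 2 * M 1 1 ^ 2]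

/-- The coordinate ring of `p` copies of the space of binary quadratic forms. -/
abbrev CoordRing (p : ℕ) : Type := MvPolynomial (Idx (fun _ : Fin p => 2)) ℂ

/-- The generic coefficient vector of the `i`-th quadratic form. -/
def coords (i : Fin p) : Fin 3 → CoordRing p := fun k => X ⟨i, k⟩

/-- The quadratic invariant of the forms `i` and `j`. -/
def quadInv (i j : Fin p) : CoordRing p := pairing (coords i) (coords j)

/-- The cubic invariant of the forms `i`, `j` and `k`. -/
def cubicInv (i j k : Fin p) : CoordRing p := pairing (coords i) (cross (coords j) (coords k))

lemma genForm_two (i : Fin p) :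
    genForm (fun _ : Fin p => 2) i =
      C (coords i 0) * X 0 ^ 2 + C (coords i 1) * X 0 * X 1 + C (coords i 2) * X 1 ^ 2 := by
  rw [genForm]
  change ∑ k : Fin 3, C (coords i k) * X 0 ^ (2 - (k : ℕ)) * X 1 ^ (k : ℕ) = _
  simp [Fin.sum_univ_three]

lemma constantCoeff_transvectant_two {A : Type*} [CommRing A] [Algebra ℂ A] (u v : Fin 3 → A) :
    constantCoeff (transvectant 2 2 2
      (C (u 0) * X 0 ^ 2 + C (u 1) * X 0 * X 1 + C (u 2) * X 1 ^ 2)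
      (C (v 0) * X 0 ^ 2 + C (v 1) * X 0 * X 1 + C (v 2) * X 1 ^ 2)) =
      (2⁻¹ : ℂ) • pairing u v := by
  simp [transvectant, Finset.sum_range_succ, pd, Derivation.leibniz, pderiv_X,
    MvPolynomial.algebraMap_apply, Algebra.smul_def, pairing]
  have h4 : algebraMap ℂ A 2⁻¹ = 2 * algebraMap ℂ A 4⁻¹ := by
    rw [← map_ofNat (algebraMap ℂ A) 2, ← map_mul]; norm_num
  have h2 : constantCoeff (2 : MvPolynomial (Fin 2) A) = 2 := map_ofNat _ 2
  rw [h4, h2]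
  ring

lemma transvectant_one {A : Type*} [CommRing A] [Algebra ℂ A] (u v : Fin 3 → A) :
    transvectant 2 2 1
      (C (u 0) * X 0 ^ 2 + C (u 1) * X 0 * X 1 + C (u 2) * X 1 ^ 2)
      (C (v 0) * X 0 ^ 2 + C (v 1) * X 0 * X 1 + C (v 2) * X 1 ^ 2) =
      (C (((2⁻¹ : ℂ) • cross u v) 0) * X 0 ^ 2 + C (((2⁻¹ : ℂ) • cross u v) 1) * X 0 * X 1 +
        C (((2⁻¹ : ℂ) • cross u v) 2) * X 1 ^ 2) := by
  simp [transvectant, Finset.sum_range_succ, pd, Derivation.leibniz, pderiv_X,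
    MvPolynomial.algebraMap_apply, Algebra.smul_def, cross]
  have h4 : algebraMap ℂ A 2⁻¹ = 2 * algebraMap ℂ A 4⁻¹ := by
    rw [← map_ofNat (algebraMap ℂ A) 2, ← map_mul]; norm_num
  have h2 : (C 2 : MvPolynomial (Fin 2) A) = 2 := map_ofNat _ 2
  rw [h4, C_mul, h2]
  ring

lemma constantCoeff_transvectant_genForm (i j : Fin p) :
    constantCoeff (transvectant 2 2 2 (genForm (fun _ => 2) i) (genForm (fun _ => 2) j)) =
      (2⁻¹ : ℂ) • quadInv i j := by
  rw [genForm_two, genForm_two, constantCoeff_transvectant_two, quadInv]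

lemma constantCoeff_transvectant_transvectant_genForm (i j k : Fin p) :
    constantCoeff (transvectant 2 2 2 (genForm (fun _ => 2) i)
      (transvectant 2 2 1 (genForm (fun _ => 2) j) (genForm (fun _ => 2) k))) =
      (4⁻¹ : ℂ) • cubicInv i j k := by
  rw [genForm_two, genForm_two, genForm_two, transvectant_one, constantCoeff_transvectant_two,
    cubicInv]
  have : pairing (coords i) ((2⁻¹ : ℂ) • cross (coords j) (coords k)) =
      (2⁻¹ : ℂ) • pairing (coords i) (cross (coords j) (coords k)) := by
    simp only [pairing, Pi.smul_apply, MvPolynomial.smul_eq_C_mul]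
    ring
  rw [this, smul_smul]
  norm_num

lemma formAt_two (c : Idx (fun _ : Fin p => 2) → ℂ) (i : Fin p) :
    formAt (fun _ => 2) c i =
      C (c ⟨i, (0 : Fin 3)⟩) * X 0 ^ 2 + C (c ⟨i, (1 : Fin 3)⟩) * X 0 * X 1 +
        C (c ⟨i, (2 : Fin 3)⟩) * X 1 ^ 2 := by
  rw [formAt]
  change ∑ k : Fin 3, C (c ⟨i, k⟩) * X 0 ^ (2 - (k : ℕ)) * X 1 ^ (k : ℕ) = _
  simp [Fin.sum_univ_three]

lemma coeffAt_two (u : Fin 3 → ℂ) (i : Fin p) (k : Fin 3) :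
    coeffAt (fun _ : Fin p => 2) ⟨i, k⟩
      (C (u 0) * X 0 ^ 2 + C (u 1) * X 0 * X 1 + C (u 2) * X 1 ^ 2) = u k := by
  have hm : (C (u 0) * X 0 ^ 2 + C (u 1) * X 0 * X 1 + C (u 2) * X 1 ^ 2 :
      MvPolynomial (Fin 2) ℂ) =
      monomial (Finsupp.single 0 2) (u 0) + monomial (Finsupp.single 0 1 + Finsupp.single 1 1) (u 1)
        + monomial (Finsupp.single 1 2) (u 2) := by
    simp [MvPolynomial.monomial_eq, Finsupp.prod_add_index', pow_add]
    ring
  rw [hm]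
  fin_cases k <;>
    simp [coeffAt, coeff_monomial, Finsupp.ext_iff, Fin.forall_fin_two, Finsupp.single_apply]

lemma actPt_two (g : Matrix.SpecialLinearGroup (Fin 2) ℂ) (c : Idx (fun _ : Fin p => 2) → ℂ)
    (i : Fin p) (k : Fin 3) :
    actPt (fun _ => 2) g c ⟨i, k⟩ =
      subst ((g⁻¹ : Matrix.SpecialLinearGroup (Fin 2) ℂ) : Matrix (Fin 2) (Fin 2) ℂ)
        (fun l : Fin 3 => c ⟨i, l⟩) k := by
  rw [← coeffAt_two (subst _ _) i k, actPt, formAt_two]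
  congr 1
  simp only [sl2Act, map_add, map_mul, map_pow, aeval_X, aeval_C, Fin.sum_univ_two, subst,
    MvPolynomial.algebraMap_eq, Matrix.cons_val_zero, Matrix.cons_val_one, Matrix.cons_val,
    map_ofNat]
  ring

lemma pairing_subst {A : Type*} [CommRing A] (M : Matrix (Fin 2) (Fin 2) A) (u v : Fin 3 → A) :
    pairing (subst M u) (subst M v) = M.det ^ 2 * pairing u v := by
  simp [pairing, subst, Matrix.det_fin_two]
  ring

lemma cross_subst {A : Type*} [CommRing A] (M : Matrix (Fin 2) (Fin 2) A) (u v : Fin 3 → A) :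
    cross (subst M u) (subst M v) = M.det • subst M (cross u v) := by
  ext k
  fin_cases k <;> simp [cross, subst, Matrix.det_fin_two] <;> ring

lemma eval_pairing (c : Idx (fun _ : Fin p => 2) → ℂ) (u v : Fin 3 → CoordRing p) :
    eval c (pairing u v) = pairing (fun k => eval c (u k)) (fun k => eval c (v k)) := by
  simp [pairing]

lemma eval_cross (c : Idx (fun _ : Fin p => 2) → ℂ) (u v : Fin 3 → CoordRing p) :
    (fun k => eval c (cross u v k)) = cross (fun k => eval c (u k)) (fun k => eval c (v k)) := by
  ext k
  fin_cases k <;> simp [cross]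

lemma eval_actPt_coords (g : Matrix.SpecialLinearGroup (Fin 2) ℂ)
    (c : Idx (fun _ : Fin p => 2) → ℂ) (i : Fin p) :
    (fun k => eval (actPt (fun _ => 2) g c) (coords i k)) =
      subst ((g⁻¹ : Matrix.SpecialLinearGroup (Fin 2) ℂ) : Matrix (Fin 2) (Fin 2) ℂ)
        (fun k => eval c (coords i k)) := by
  ext k
  simp [coords, actPt_two]

lemma quadInv_mem_invariantRing (i j : Fin p) :
    quadInv i j ∈ invariantRing (fun _ : Fin p => 2) := fun g c => by
  rw [quadInv, eval_pairing, eval_pairing, eval_actPt_coords, eval_actPt_coords, pairing_subst,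
    Matrix.SpecialLinearGroup.det_coe, one_pow, one_mul]

lemma cubicInv_mem_invariantRing (i j k : Fin p) :
    cubicInv i j k ∈ invariantRing (fun _ : Fin p => 2) := fun g c => by
  rw [cubicInv, eval_pairing, eval_pairing, eval_cross, eval_cross, eval_actPt_coords,
    eval_actPt_coords, eval_actPt_coords, cross_subst, Matrix.SpecialLinearGroup.det_coe, one_smul,
    pairing_subst, Matrix.SpecialLinearGroup.det_coe, one_pow, one_mul]

lemma isHomogeneous_quadInv (i j : Fin p) : (quadInv i j).IsHomogeneous 2 := by
  have h (k l : Fin 3) : (coords i k * coords j l).IsHomogeneous 2 :=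
    (isHomogeneous_X ℂ _).mul (isHomogeneous_X ℂ _)
  have h2 (k l : Fin 3) : (2 * coords i k * coords j l).IsHomogeneous 2 := by
    rw [mul_assoc, two_mul]
    exact (h k l).add (h k l)
  exact ((h2 0 2).add (h2 2 0)).sub (h 1 1)

section Omega

variable {R : Type*} [CommRing R]

/-- Cayley's Ω-operator on polynomial functions of a `2 × 2` matrix. -/
def omega : MvPolynomial (Fin 2 × Fin 2) R →ₗ[R] MvPolynomial (Fin 2 × Fin 2) R :=
  (pderiv (0, 0)).toLinearMap ∘ₗ (pderiv (1, 1)).toLinearMap -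
    (pderiv (1, 0)).toLinearMap ∘ₗ (pderiv (0, 1)).toLinearMap

/-- The bidifferential operator measuring the failure of `omega` to be a derivation, as a
derivation in one argument. -/
def omegaPolar (h : MvPolynomial (Fin 2 × Fin 2) R) :
    Derivation R (MvPolynomial (Fin 2 × Fin 2) R) (MvPolynomial (Fin 2 × Fin 2) R) :=
  pderiv (1, 1) h • pderiv (0, 0) - pderiv (0, 1) h • pderiv (1, 0)

/-- The determinant of the generic `2 × 2` matrix. -/
def genDet : MvPolynomial (Fin 2 × Fin 2) R := (Matrix.mvPolynomialX (Fin 2) (Fin 2) R).det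

/-- The coefficients of a binary quadratic form transformed by the generic `2 × 2` matrix. -/
def genSubst (u : Fin 3 → R) : Fin 3 → MvPolynomial (Fin 2 × Fin 2) R :=
  subst (Matrix.mvPolynomialX (Fin 2) (Fin 2) R) (fun k => C (u k))

lemma pderiv_two (i : Fin 2 × Fin 2) : pderiv i (2 : MvPolynomial (Fin 2 × Fin 2) R) = 0 := by
  rw [← map_ofNat C 2, pderiv_C]

lemma omega_apply (f : MvPolynomial (Fin 2 × Fin 2) R) :
    omega f = pderiv (0, 0) (pderiv (1, 1) f) - pderiv (1, 0) (pderiv (0, 1) f) := rfl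

lemma omegaPolar_apply (f h : MvPolynomial (Fin 2 × Fin 2) R) :
    omegaPolar h f =
      pderiv (1, 1) h * pderiv (0, 0) f - pderiv (0, 1) h * pderiv (1, 0) f := rfl

lemma omegaPolar_add (f h k : MvPolynomial (Fin 2 × Fin 2) R) :
    omegaPolar (h + k) f = omegaPolar h f + omegaPolar k f := by
  simp only [omegaPolar_apply, map_add]; ring

lemma omegaPolar_mul (f h k : MvPolynomial (Fin 2 × Fin 2) R) :
    omegaPolar (h * k) f = h * omegaPolar k f + k * omegaPolar h f := by
  simp only [omegaPolar_apply, Derivation.leibniz, smul_eq_mul]; ring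

lemma omega_mul (f g : MvPolynomial (Fin 2 × Fin 2) R) :
    omega (f * g) = f * omega g + g * omega f + omegaPolar g f + omegaPolar f g := by
  simp only [omega_apply, omegaPolar_apply, Derivation.leibniz, smul_eq_mul, map_add]; ring

lemma genDet_eq :
    (genDet : MvPolynomial (Fin 2 × Fin 2) R) = X (0, 0) * X (1, 1) - X (0, 1) * X (1, 0) := by
  simp [genDet, Matrix.det_fin_two]

lemma omega_genDet : omega (genDet : MvPolynomial (Fin 2 × Fin 2) R) = 2 := by
  simp [omega_apply, genDet_eq, Derivation.leibniz, pderiv_X]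
  norm_num

lemma omegaPolar_genDet_genDet :
    omegaPolar (genDet : MvPolynomial (Fin 2 × Fin 2) R) genDet = genDet := by
  simp [omegaPolar_apply, genDet_eq, Derivation.leibniz, pderiv_X]
  ring

lemma omegaPolar_genDet_genDet_pow (d : ℕ) :
    omegaPolar (genDet ^ d) (genDet : MvPolynomial (Fin 2 × Fin 2) R) =
      (d : MvPolynomial (Fin 2 × Fin 2) R) * genDet ^ d := by
  induction d with
  | zero => simp [omegaPolar_apply]
  | succ d ih => rw [pow_succ, omegaPolar_mul, omegaPolar_genDet_genDet, ih]; push_cast; ring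

lemma omegaPolar_genDet_pow_genDet (d : ℕ) :
    omegaPolar (genDet : MvPolynomial (Fin 2 × Fin 2) R) (genDet ^ d) =
      (d : MvPolynomial (Fin 2 × Fin 2) R) * genDet ^ d := by
  induction d with
  | zero => simp
  | succ d ih =>
    rw [pow_succ, Derivation.leibniz, omegaPolar_genDet_genDet, ih]
    push_cast [smul_eq_mul]; ring

lemma omega_genDet_pow_succ (d : ℕ) :
    omega (genDet ^ (d + 1) : MvPolynomial (Fin 2 × Fin 2) R) =
      ((d + 1) * (d + 2) : R) • genDet ^ d := by
  rw [MvPolynomial.smul_eq_C_mul]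
  induction d with
  | zero => simp [omega_genDet, map_ofNat C 2]
  | succ d ih =>
    rw [pow_succ, omega_mul, omega_genDet, ih, omegaPolar_genDet_genDet_pow,
      omegaPolar_genDet_pow_genDet]
    simp only [map_mul, map_add, map_natCast, map_one, map_ofNat]
    push_cast
    ring

lemma constantCoeff_omega_pow_genDet_pow (k d : ℕ) :
    constantCoeff ((omega ^ k) (genDet ^ d : MvPolynomial (Fin 2 × Fin 2) R)) =
      if d = k then ((d.factorial * (d + 1).factorial : ℕ) : R) else 0 := by
  induction k generalizing d with
  | zero =>
    rcases d with _ | d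
    · simp
    · simp [genDet_eq]
  | succ k ih =>
    rcases d with _ | d
    · rw [pow_succ, Module.End.mul_apply]
      simp [omega_apply]
    · rw [pow_succ, Module.End.mul_apply, omega_genDet_pow_succ, map_smul, constantCoeff_smul, ih]
      by_cases h : d = k
      · simp only [h, if_true, smul_eq_mul, Nat.factorial_succ]
        push_cast
        ring
      · simp [h]

lemma genSubst_zero (u : Fin 3 → R) : genSubst u 0 = C (u 0) * X (0, 0) ^ 2 +
    C (u 1) * X (0, 0) * X (1, 0) + C (u 2) * X (1, 0) ^ 2 := rfl

lemma genSubst_one (u : Fin 3 → R) : genSubst u 1 = 2 * C (u 0) * X (0, 0) * X (0, 1) +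
    C (u 1) * (X (0, 0) * X (1, 1) + X (1, 0) * X (0, 1)) +
    2 * C (u 2) * X (1, 0) * X (1, 1) := rfl

lemma genSubst_two (u : Fin 3 → R) : genSubst u 2 = C (u 0) * X (0, 1) ^ 2 +
    C (u 1) * X (0, 1) * X (1, 1) + C (u 2) * X (1, 1) ^ 2 := rfl

lemma omega_genSubst (u : Fin 3 → R) (k : Fin 3) : omega (genSubst u k) = 0 := by
  fin_cases k <;>
    simp [omega_apply, genSubst_zero, genSubst_one, genSubst_two, Derivation.leibniz, pderiv_X,
      pderiv_two]

lemma omegaPolar_genSubst_genDet (u : Fin 3 → R) (k : Fin 3) :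
    omegaPolar (genSubst u k) genDet = (k : ℕ) * genSubst u k := by
  fin_cases k <;>
    simp [omegaPolar_apply, genDet_eq, genSubst_zero, genSubst_one, genSubst_two,
      Derivation.leibniz, pderiv_X, pderiv_two] <;> ring

lemma omegaPolar_genDet_genSubst (u : Fin 3 → R) (k : Fin 3) :
    omegaPolar genDet (genSubst u k) = ((2 - k : ℕ) : MvPolynomial _ R) * genSubst u k := by
  fin_cases k <;>
    simp [omegaPolar_apply, genDet_eq, genSubst_zero, genSubst_one, genSubst_two,
      Derivation.leibniz, pderiv_X, pderiv_two] <;> ring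

lemma omegaPolar_genSubst_genSubst_zero (u v : Fin 3 → R) (k : Fin 3) :
    omegaPolar (genSubst v 0) (genSubst u k) = 0 := by
  simp [omegaPolar_apply, genSubst_zero, Derivation.leibniz, pderiv_X]

lemma omegaPolar_genSubst_two_genSubst (u v : Fin 3 → R) (k : Fin 3) :
    omegaPolar (genSubst v k) (genSubst u 2) = 0 := by
  simp [omegaPolar_apply, genSubst_two, Derivation.leibniz, pderiv_X]

lemma omegaPolar_genSubst_one_genSubst_zero (u v : Fin 3 → R) :
    omegaPolar (genSubst v 1) (genSubst u 0) = 2 * genSubst (cross u v) 0 := by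
  simp [omegaPolar_apply, genSubst_zero, genSubst_one, Derivation.leibniz, pderiv_X, pderiv_two,
    cross, map_ofNat C 2]
  ring

lemma omegaPolar_genSubst_two_genSubst_one (u v : Fin 3 → R) :
    omegaPolar (genSubst v 2) (genSubst u 1) = 2 * genSubst (cross u v) 2 := by
  simp [omegaPolar_apply, genSubst_two, genSubst_one, Derivation.leibniz, pderiv_X, pderiv_two,
    cross, map_ofNat C 2]
  ring

lemma omegaPolar_genSubst_two_genSubst_zero (u v : Fin 3 → R) :
    omegaPolar (genSubst v 2) (genSubst u 0) =
      genSubst (cross u v) 1 + C (pairing u v) * genDet := by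
  simp [omegaPolar_apply, genSubst_zero, genSubst_one, genSubst_two, Derivation.leibniz, pderiv_X,
    cross, pairing, genDet_eq, map_ofNat C 2]
  ring

lemma omegaPolar_genSubst_one_genSubst_one (u v : Fin 3 → R) :
    omegaPolar (genSubst v 1) (genSubst u 1) =
      genSubst (cross u v) 1 - C (pairing u v) * genDet := by
  simp [omegaPolar_apply, genSubst_one, Derivation.leibniz, pderiv_X, pderiv_two,
    cross, pairing, genDet_eq, map_ofNat C 2]
  ring

end Omega

/-- The algebra generated by the quadratic and cubic invariants. -/
def basicInvariants (p : ℕ) : Subalgebra ℂ (CoordRing p) :=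
  Algebra.adjoin ℂ ({P | ∃ i j, P = quadInv i j} ∪ {P | ∃ i j k, P = cubicInv i j k})

lemma quadInv_mem_basicInvariants (i j : Fin p) : quadInv i j ∈ basicInvariants p :=
  Algebra.subset_adjoin (.inl ⟨i, j, rfl⟩)

lemma cubicInv_mem_basicInvariants (i j k : Fin p) : cubicInv i j k ∈ basicInvariants p :=
  Algebra.subset_adjoin (.inr ⟨i, j, k, rfl⟩)

/-- The covariant quadratic forms, up to invariant multiples. -/
def covariants (p : ℕ) : Submodule (basicInvariants p) (Fin 3 → CoordRing p) :=
  Submodule.span _ ({w | ∃ i, w = coords i} ∪ {w | ∃ i j, w = cross (coords i) (coords j)})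

section Bilinear

variable {A : Type*} [CommRing A]

lemma pairing_comm (u v : Fin 3 → A) : pairing u v = pairing v u := by
  simp only [pairing]; ring

lemma cross_comm (u v : Fin 3 → A) : cross u v = -cross v u := by
  ext k
  fin_cases k <;> simp [cross] <;> ring

lemma pairing_add (u v w : Fin 3 → A) : pairing u (v + w) = pairing u v + pairing u w := by
  simp only [pairing, Pi.add_apply]; ring

lemma pairing_smul (r : A) (u v : Fin 3 → A) : pairing u (r • v) = r * pairing u v := by
  simp only [pairing, Pi.smul_apply, smul_eq_mul]; ring

lemma cross_add (u v w : Fin 3 → A) : cross u (v + w) = cross u v + cross u w := by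
  ext k
  fin_cases k <;> simp [cross] <;> ring

lemma cross_smul (r : A) (u v : Fin 3 → A) : cross u (r • v) = r • cross u v := by
  ext k
  fin_cases k <;> simp [cross] <;> ring

lemma cross_cross (u v w : Fin 3 → A) :
    cross u (cross v w) = pairing u w • v - pairing u v • w := by
  ext k
  fin_cases k <;> simp [cross, pairing] <;> ring

lemma pairing_cross_cross (t u v w : Fin 3 → A) :
    pairing (cross t u) (cross v w) = pairing t v * pairing u w - pairing t w * pairing u v := by
  simp [cross, pairing]
  ring

end Bilinear

lemma smul_mem_covariants {r : CoordRing p} (hr : r ∈ basicInvariants p)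
    {w : Fin 3 → CoordRing p} (hw : w ∈ covariants p) : r • w ∈ covariants p :=
  (covariants p).smul_mem ⟨r, hr⟩ hw

lemma coords_mem_covariants (i : Fin p) : coords i ∈ covariants p :=
  Submodule.subset_span (.inl ⟨i, rfl⟩)

lemma cross_coords_mem_covariants (i j : Fin p) :
    cross (coords i) (coords j) ∈ covariants p :=
  Submodule.subset_span (.inr ⟨i, j, rfl⟩)

lemma covariants_induction {u : Fin 3 → CoordRing p} (hu : u ∈ covariants p)
    {motive : (Fin 3 → CoordRing p) → Prop} (h1 : ∀ i, motive (coords i))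
    (h2 : ∀ i j, motive (cross (coords i) (coords j))) (h0 : motive 0)
    (hadd : ∀ v w, motive v → motive w → motive (v + w))
    (hsmul : ∀ r ∈ basicInvariants p, ∀ v, motive v → motive (r • v)) : motive u := by
  induction hu using Submodule.span_induction with
  | mem x hx =>
    rcases hx with ⟨i, rfl⟩ | ⟨i, j, rfl⟩
    · exact h1 i
    · exact h2 i j
  | zero => exact h0
  | add v w _ _ hv hw => exact hadd v w hv hw
  | smul r v _ hv => exact hsmul r r.2 v hv

lemma pairing_zero {A : Type*} [CommRing A] (u : Fin 3 → A) : pairing u 0 = 0 := by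
  simp [pairing]

lemma cross_zero {A : Type*} [CommRing A] (u : Fin 3 → A) : cross u 0 = 0 := by
  ext k
  fin_cases k <;> simp [cross]

lemma pairing_mem_basicInvariants {u v : Fin 3 → CoordRing p} (hu : u ∈ covariants p)
    (hv : v ∈ covariants p) : pairing u v ∈ basicInvariants p := by
  refine covariants_induction (motive := fun v => pairing u v ∈ basicInvariants p) hv
    (fun k => ?_) (fun k l => ?_) ?_ ?_ ?_
  · rw [pairing_comm]
    refine covariants_induction
      (motive := fun u => pairing (coords k) u ∈ basicInvariants p) hu
      (fun i => ?_) (fun i j => ?_) ?_ ?_ ?_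
    · exact quadInv_mem_basicInvariants k i
    · exact cubicInv_mem_basicInvariants k i j
    · rw [pairing_zero]; exact zero_mem _
    · intro v w hv hw; rw [pairing_add]; exact add_mem hv hw
    · intro r hr v hv; rw [pairing_smul]; exact mul_mem hr hv
  · rw [pairing_comm]
    refine covariants_induction
      (motive := fun u => pairing (cross (coords k) (coords l)) u ∈ basicInvariants p) hu
      (fun i => ?_) (fun i j => ?_) ?_ ?_ ?_
    · rw [pairing_comm]; exact cubicInv_mem_basicInvariants i k l
    · rw [pairing_cross_cross]
      exact sub_mem (mul_mem (quadInv_mem_basicInvariants _ _) (quadInv_mem_basicInvariants _ _))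
        (mul_mem (quadInv_mem_basicInvariants _ _) (quadInv_mem_basicInvariants _ _))
    · rw [pairing_zero]; exact zero_mem _
    · intro v w hv hw; rw [pairing_add]; exact add_mem hv hw
    · intro r hr v hv; rw [pairing_smul]; exact mul_mem hr hv
  · rw [pairing_zero]; exact zero_mem _
  · intro v w hv hw; rw [pairing_add]; exact add_mem hv hw
  · intro r hr v hv; rw [pairing_smul]; exact mul_mem hr hv

lemma cross_mem_covariants {u v : Fin 3 → CoordRing p} (hu : u ∈ covariants p)
    (hv : v ∈ covariants p) : cross u v ∈ covariants p := by
  refine covariants_induction (motive := fun v => cross u v ∈ covariants p) hv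
    (fun k => ?_) (fun k l => ?_) ?_ ?_ ?_
  · rw [cross_comm]
    refine neg_mem (covariants_induction
      (motive := fun u => cross (coords k) u ∈ covariants p) hu
      (fun i => ?_) (fun i j => ?_) ?_ ?_ ?_)
    · exact cross_coords_mem_covariants k i
    · rw [cross_cross]
      exact sub_mem
        (smul_mem_covariants (quadInv_mem_basicInvariants _ _) (coords_mem_covariants _))
        (smul_mem_covariants (quadInv_mem_basicInvariants _ _) (coords_mem_covariants _))
    · rw [cross_zero]; exact zero_mem _
    · intro v w hv hw; rw [cross_add]; exact add_mem hv hw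
    · intro r hr v hv; rw [cross_smul]; exact smul_mem_covariants hr hv
  · rw [cross_cross]
    exact sub_mem
      (smul_mem_covariants (pairing_mem_basicInvariants hu (coords_mem_covariants _))
        (coords_mem_covariants _))
      (smul_mem_covariants (pairing_mem_basicInvariants hu (coords_mem_covariants _))
        (coords_mem_covariants _))
  · rw [cross_zero]; exact zero_mem _
  · intro v w hv hw; rw [cross_add]; exact add_mem hv hw
  · intro r hr v hv; rw [cross_smul]; exact smul_mem_covariants hr hv

/-- The generators of `chainAlgebra`. -/
def chainGens (p : ℕ) : Set (MvPolynomial (Fin 2 × Fin 2) (CoordRing p)) :=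
  {genDet} ∪ {f | ∃ u ∈ covariants p, ∃ k, f = genSubst u k}

/-- An algebra of polynomials in the entries of a `2 × 2` matrix that contains the pullbacks of
all polynomial functions of the transformed forms and that is stable under `omega`. -/
def chainAlgebra (p : ℕ) :
    Subalgebra (basicInvariants p) (MvPolynomial (Fin 2 × Fin 2) (CoordRing p)) :=
  Algebra.adjoin _ (chainGens p)

lemma genDet_mem_chainAlgebra : genDet ∈ chainAlgebra p := Algebra.subset_adjoin (.inl rfl)

lemma genSubst_mem_chainAlgebra {u : Fin 3 → CoordRing p} (hu : u ∈ covariants p) (k : Fin 3) :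
    genSubst u k ∈ chainAlgebra p := Algebra.subset_adjoin (.inr ⟨u, hu, k, rfl⟩)

lemma C_mem_chainAlgebra {r : CoordRing p} (hr : r ∈ basicInvariants p) :
    C r ∈ chainAlgebra p := (chainAlgebra p).algebraMap_mem ⟨r, hr⟩

lemma omegaPolar_genSubst_mem {u v : Fin 3 → CoordRing p} (hu : u ∈ covariants p)
    (hv : v ∈ covariants p) (k l : Fin 3) :
    omegaPolar (genSubst v l) (genSubst u k) ∈ chainAlgebra p := by
  have h2 : (2 : MvPolynomial (Fin 2 × Fin 2) (CoordRing p)) ∈ chainAlgebra p := ofNat_mem _ 2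
  have hc (k : Fin 3) := genSubst_mem_chainAlgebra (cross_mem_covariants hu hv) k
  have hp := mul_mem (C_mem_chainAlgebra (pairing_mem_basicInvariants hu hv))
    (genDet_mem_chainAlgebra (p := p))
  fin_cases l <;> fin_cases k <;> dsimp only [Fin.reduceFinMk, Fin.zero_eta, Fin.mk_one]
  · rw [omegaPolar_genSubst_genSubst_zero]; exact zero_mem _
  · rw [omegaPolar_genSubst_genSubst_zero]; exact zero_mem _
  · rw [omegaPolar_genSubst_genSubst_zero]; exact zero_mem _
  · rw [omegaPolar_genSubst_one_genSubst_zero]; exact mul_mem h2 (hc 0)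
  · rw [omegaPolar_genSubst_one_genSubst_one]; exact sub_mem (hc 1) hp
  · rw [omegaPolar_genSubst_two_genSubst]; exact zero_mem _
  · rw [omegaPolar_genSubst_two_genSubst_zero]; exact add_mem (hc 1) hp
  · rw [omegaPolar_genSubst_two_genSubst_one]; exact mul_mem h2 (hc 2)
  · rw [omegaPolar_genSubst_two_genSubst]; exact zero_mem _

lemma omegaPolar_chainGens_mem {f g : MvPolynomial (Fin 2 × Fin 2) (CoordRing p)}
    (hf : f ∈ chainGens p) (hg : g ∈ chainGens p) : omegaPolar g f ∈ chainAlgebra p := by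
  rcases hf with rfl | ⟨u, hu, k, rfl⟩ <;> rcases hg with rfl | ⟨v, hv, l, rfl⟩
  · rw [omegaPolar_genDet_genDet]; exact genDet_mem_chainAlgebra
  · rw [omegaPolar_genSubst_genDet]
    exact mul_mem (natCast_mem _ _) (genSubst_mem_chainAlgebra hv l)
  · rw [omegaPolar_genDet_genSubst]
    exact mul_mem (natCast_mem _ _) (genSubst_mem_chainAlgebra hu k)
  · exact omegaPolar_genSubst_mem hu hv k l

lemma omegaPolar_algebraMap_right (r : basicInvariants p)
    (g : MvPolynomial (Fin 2 × Fin 2) (CoordRing p)) :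
    omegaPolar g (algebraMap _ _ r) = 0 := by
  change omegaPolar g (C (r : CoordRing p)) = 0
  simp

lemma omegaPolar_algebraMap_left (r : basicInvariants p)
    (g : MvPolynomial (Fin 2 × Fin 2) (CoordRing p)) :
    omegaPolar (algebraMap _ _ r) g = 0 := by
  change omegaPolar (C (r : CoordRing p)) g = 0
  simp [omegaPolar_apply]

lemma omegaPolar_mem_chainAlgebra {f g : MvPolynomial (Fin 2 × Fin 2) (CoordRing p)}
    (hf : f ∈ chainAlgebra p) (hg : g ∈ chainAlgebra p) :
    omegaPolar g f ∈ chainAlgebra p := by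
  induction hg using Algebra.adjoin_induction with
  | mem g hg =>
    induction hf using Algebra.adjoin_induction with
    | mem f hf => exact omegaPolar_chainGens_mem hf hg
    | algebraMap r => rw [omegaPolar_algebraMap_right]; exact zero_mem _
    | add x y _ _ hx hy => rw [map_add]; exact add_mem hx hy
    | mul x y hx' hy' hx hy =>
      rw [Derivation.leibniz]
      exact add_mem (mul_mem hx' hy) (mul_mem hy' hx)
  | algebraMap r => rw [omegaPolar_algebraMap_left]; exact zero_mem _
  | add x y _ _ hx hy => rw [omegaPolar_add]; exact add_mem hx hy
  | mul x y hx' hy' hx hy =>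
    rw [omegaPolar_mul]
    exact add_mem (mul_mem hx' hy) (mul_mem hy' hx)

lemma omega_mem_chainAlgebra {f : MvPolynomial (Fin 2 × Fin 2) (CoordRing p)}
    (hf : f ∈ chainAlgebra p) : omega f ∈ chainAlgebra p := by
  induction hf using Algebra.adjoin_induction with
  | mem f hf =>
    rcases hf with rfl | ⟨u, hu, k, rfl⟩
    · rw [omega_genDet]; exact ofNat_mem _ 2
    · rw [omega_genSubst]; exact zero_mem _
  | algebraMap r =>
    change omega (C (r : CoordRing p)) ∈ _
    rw [omega_apply]
    simp
  | add x y _ _ hx hy => rw [map_add]; exact add_mem hx hy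
  | mul x y hx' hy' hx hy =>
    rw [omega_mul]
    exact add_mem (add_mem (add_mem (mul_mem hx' hy) (mul_mem hy' hx))
      (omegaPolar_mem_chainAlgebra hx' hy')) (omegaPolar_mem_chainAlgebra hy' hx')

lemma omega_pow_mem_chainAlgebra {f : MvPolynomial (Fin 2 × Fin 2) (CoordRing p)}
    (hf : f ∈ chainAlgebra p) (k : ℕ) : (omega ^ k) f ∈ chainAlgebra p := by
  induction k with
  | zero => exact hf
  | succ k ih => rw [pow_succ', Module.End.mul_apply]; exact omega_mem_chainAlgebra ih

lemma constantCoeff_mem_basicInvariants {f : MvPolynomial (Fin 2 × Fin 2) (CoordRing p)}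
    (hf : f ∈ chainAlgebra p) : constantCoeff f ∈ basicInvariants p := by
  induction hf using Algebra.adjoin_induction with
  | mem f hf =>
    rcases hf with rfl | ⟨u, hu, k, rfl⟩
    · rw [genDet_eq]; simp
    · fin_cases k <;> simp [genSubst_zero, genSubst_one, genSubst_two]
  | algebraMap r =>
    change constantCoeff (C (r : CoordRing p)) ∈ _
    rw [constantCoeff_C]
    exact r.2
  | add x y _ _ hx hy => rw [map_add]; exact add_mem hx hy
  | mul x y _ _ hx hy => rw [map_mul]; exact mul_mem hx hy

/-- The pullback of a polynomial function along the action of the generic `2 × 2` matrix. -/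
def genericPullback (p : ℕ) : CoordRing p →ₐ[ℂ] MvPolynomial (Fin 2 × Fin 2) (CoordRing p) :=
  aeval fun j : Idx (fun _ : Fin p => 2) => genSubst (R := CoordRing p) (coords j.1) j.2

/-- The pullback of a polynomial function along scaling by the generic determinant. -/
def detPullback (p : ℕ) : CoordRing p →ₐ[ℂ] MvPolynomial (Fin 2 × Fin 2) (CoordRing p) :=
  aeval fun j => genDet * C (X j : CoordRing p)

lemma genericPullback_mem_chainAlgebra (f : CoordRing p) :
    genericPullback p f ∈ chainAlgebra p := by
  induction f using MvPolynomial.induction_on with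
  | C a =>
    rw [← MvPolynomial.algebraMap_eq, AlgHom.commutes]
    exact (chainAlgebra p).algebraMap_mem (algebraMap ℂ _ a)
  | add f g hf hg => rw [map_add]; exact add_mem hf hg
  | mul_X f j hf =>
    rw [map_mul, genericPullback, aeval_X]
    exact mul_mem hf (genSubst_mem_chainAlgebra (coords_mem_covariants _) _)

lemma detPullback_of_isHomogeneous {f : CoordRing p} {d : ℕ} (hf : f.IsHomogeneous d) :
    detPullback p f = C f * genDet ^ d := by
  rw [f.as_sum, map_sum, map_sum, Finset.sum_mul]
  refine Finset.sum_congr rfl fun m hm => ?_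
  have hd : m.degree = d := by
    rw [Finsupp.degree_eq_weight_one]; exact hf (mem_support_iff.mp hm)
  rw [detPullback, aeval_monomial, monomial_eq, C_mul, Finsupp.prod, Finsupp.prod, map_prod,
    ← hd, Finsupp.degree_apply, ← Finset.prod_pow_eq_pow_sum]
  simp only [mul_pow, map_pow, Finset.prod_mul_distrib]
  rw [show algebraMap ℂ (MvPolynomial (Fin 2 × Fin 2) (CoordRing p)) (coeff m f) =
    C (C (coeff m f)) from rfl]
  ring

lemma map_eval_ext {P Q : MvPolynomial (Fin 2 × Fin 2) (CoordRing p)}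
    (h : ∀ c x, eval x (map (eval c) P) = eval x (map (eval c) Q)) : P = Q := by
  ext m : 1
  refine MvPolynomial.funext fun c => ?_
  rw [← coeff_map, ← coeff_map, MvPolynomial.funext (h c)]

lemma eval_map_genericPullback (f : CoordRing p) (c : Idx (fun _ : Fin p => 2) → ℂ)
    (x : Fin 2 × Fin 2 → ℂ) :
    eval x (map (eval c) (genericPullback p f)) =
      eval (fun j => subst (Matrix.of fun a b => x (a, b)) (fun k : Fin 3 => c ⟨j.1, k⟩) j.2) f := by
  induction f using MvPolynomial.induction_on with
  | C a =>
    rw [← MvPolynomial.algebraMap_eq, AlgHom.commutes]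
    simp [MvPolynomial.algebraMap_apply]
  | add f g hf hg => simp only [map_add, hf, hg]
  | mul_X f j hf =>
    rw [map_mul, map_mul, map_mul, hf, map_mul, genericPullback, aeval_X, eval_X]
    congr 1
    obtain ⟨i, k⟩ := j
    change Fin 3 at k
    fin_cases k <;> simp [genSubst, subst, coords]

lemma eval_map_genDet (c : Idx (fun _ : Fin p => 2) → ℂ) (x : Fin 2 × Fin 2 → ℂ) :
    eval x (map (eval c) genDet) = (Matrix.of fun a b => x (a, b)).det := by
  simp [genDet_eq, Matrix.det_fin_two]

lemma eval_map_detPullback (f : CoordRing p) (c : Idx (fun _ : Fin p => 2) → ℂ)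
    (x : Fin 2 × Fin 2 → ℂ) :
    eval x (map (eval c) (detPullback p f)) =
      eval ((Matrix.of fun a b => x (a, b)).det • c) f := by
  induction f using MvPolynomial.induction_on with
  | C a =>
    rw [← MvPolynomial.algebraMap_eq, AlgHom.commutes]
    simp [MvPolynomial.algebraMap_apply]
  | add f g hf hg => simp only [map_add, hf, hg]
  | mul_X f j hf =>
    rw [map_mul, map_mul, map_mul, hf, map_mul, detPullback, aeval_X, eval_X, map_mul, map_mul,
      eval_map_genDet]
    simp

lemma subst_smul {A : Type*} [CommRing A] (r : A) (M : Matrix (Fin 2) (Fin 2) A) (u : Fin 3 → A) :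
    subst (r • M) u = subst M (r ^ 2 • u) := by
  ext k
  fin_cases k <;> simp [subst] <;> ring

lemma eval_subst_of_isInvariant {f : CoordRing p} (hf : f ∈ invariantRing (fun _ : Fin p => 2))
    (c : Idx (fun _ : Fin p => 2) → ℂ) {M : Matrix (Fin 2) (Fin 2) ℂ} (hM : M.det ≠ 0) :
    eval (fun j => subst M (fun k : Fin 3 => c ⟨j.1, k⟩) j.2) f = eval (M.det • c) f := by
  obtain ⟨e, he⟩ := IsAlgClosed.exists_pow_nat_eq M.det (n := 2) two_pos
  have he0 : e ≠ 0 := by rintro rfl; exact hM (by rw [← he]; simp)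
  let g : Matrix.SpecialLinearGroup (Fin 2) ℂ :=
    ⟨e⁻¹ • M, by rw [Matrix.det_smul, Fintype.card_fin, ← he]; field_simp⟩
  rw [← hf g⁻¹ (M.det • c)]
  congr 2
  ext ⟨i, k⟩
  rw [actPt_two, inv_inv]
  change _ = subst (e⁻¹ • M) _ k
  rw [subst_smul, ← he]
  congr 1
  ext l
  simp only [Pi.smul_apply, smul_eq_mul]
  field_simp

lemma genericPullback_eq_detPullback {f : CoordRing p}
    (hf : f ∈ invariantRing (fun _ : Fin p => 2)) : genericPullback p f = detPullback p f := by
  have h0 : (genDet : MvPolynomial (Fin 2 × Fin 2) (CoordRing p)) ≠ 0 :=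
    Matrix.det_mvPolynomialX_ne_zero _ _
  refine mul_left_cancel₀ h0 (map_eval_ext fun c x => ?_)
  rw [map_mul, map_mul, map_mul, map_mul, eval_map_genDet, eval_map_genericPullback,
    eval_map_detPullback]
  by_cases hx : (Matrix.of fun a b => x (a, b)).det = 0
  · rw [hx, zero_mul, zero_mul]
  · rw [eval_subst_of_isInvariant hf c hx]

/-- The first fundamental theorem for several binary quadratic forms. -/
theorem basicInvariants_eq_invariantRing :
    basicInvariants p = invariantRing (fun _ : Fin p => 2) := by
  refine le_antisymm (Algebra.adjoin_le ?_) fun f hf => ?_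
  · rintro _ (⟨i, j, rfl⟩ | ⟨i, j, k, rfl⟩)
    · exact quadInv_mem_invariantRing i j
    · exact cubicInv_mem_invariantRing i j k
  · rw [← sum_homogeneousComponent f]
    refine sum_mem fun k hk => ?_
    have hmem := constantCoeff_mem_basicInvariants
      (omega_pow_mem_chainAlgebra (genericPullback_mem_chainAlgebra f) k)
    rw [genericPullback_eq_detPullback hf] at hmem
    conv at hmem => rw [← sum_homogeneousComponent f]
    simp only [map_sum, detPullback_of_isHomogeneous (homogeneousComponent_isHomogeneous _ f),
      ← MvPolynomial.smul_eq_C_mul, map_smul, constantCoeff_smul,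
      constantCoeff_omega_pow_genDet_pow, smul_ite, smul_zero] at hmem
    rw [Finset.sum_ite_eq', if_pos hk, smul_eq_mul, mul_comm, ← nsmul_eq_mul] at hmem
    have hc : ((k.factorial * (k + 1).factorial : ℕ) : ℂ) ≠ 0 := by
      exact_mod_cast (Nat.mul_pos (Nat.factorial_pos _) (Nat.factorial_pos _)).ne'
    have := (basicInvariants p).smul_mem hmem ((k.factorial * (k + 1).factorial : ℕ) : ℂ)⁻¹
    rwa [← Nat.cast_smul_eq_nsmul ℂ, smul_smul, inv_mul_cancel₀ hc, one_smul] at this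

/-- A symmetric matrix of rank at most three with zero diagonal and vanishing antidiagonal
sums is zero. -/
lemma eq_zero_of_minors_eq_zero {k : Type*} [Field k] (r : Fin p → Fin p → k)
    (hsymm : ∀ i j, r i j = r j i) (hdiag : ∀ i, r i i = 0)
    (hanti : ∀ n : ℕ, ∑ x : Fin p × Fin p with x.1 < x.2 ∧ (x.1 : ℕ) + x.2 = n, r x.1 x.2 = 0)
    (hminor : ∀ a b : Fin 4 → Fin p, (Matrix.of fun x y => r (a x) (b y)).det = 0)
    (i j : Fin p) : r i j = 0 := by
  obtain ⟨n, hn⟩ : ∃ n, n = (i : ℕ) + j := ⟨_, rfl⟩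
  induction n using Nat.strong_induction_on generalizing i j with
  | _ n ih =>
  have key : ∀ i i' j' j : Fin p, i < i' → i' < j' → j' < j → (i : ℕ) + j = n →
      (i' : ℕ) + j' = n → r i j = 0 ∨ r i' j' = 0 := by
    intro i i' j' j h1 h2 h3 h4 h5
    have hdet := hminor ![i, i', j', j] ![j, j', i', i]
    have z1 : r i j' = 0 := ih (i + j') (by omega) _ _ rfl
    have z2 : r i i' = 0 := ih (i + i') (by omega) _ _ rfl
    have z3 : r i i = 0 := hdiag i
    have z4 : r i' i' = 0 := hdiag i'
    have z5 : r i' i = 0 := ih (i' + i) (by omega) _ _ rfl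
    have z6 : r j' i = 0 := ih (j' + i) (by omega) _ _ rfl
    rw [Matrix.det_of_isLowerTriangular] at hdet
    · simp [Fin.prod_univ_four, hsymm j' i', hsymm j i] at hdet
      tauto
    · intro x y hxy
      fin_cases x <;> fin_cases y <;> first | (exfalso; revert hxy; decide) | simp [*]
  have step : ∀ i j : Fin p, i < j → (i : ℕ) + j = n → r i j = 0 := by
    intro i j hij hn
    by_contra hne
    have := hanti n
    rw [Finset.sum_eq_single (i, j)] at this
    · exact hne this
    · rintro ⟨i', j'⟩ hx hne'
      simp only [Finset.mem_filter, Finset.mem_univ, true_and] at hx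
      rcases lt_trichotomy i i' with h | h | h
      · exact (key i i' j' j h hx.1 (by omega) hn hx.2).resolve_left hne
      · exact absurd (Prod.ext h.symm (Fin.ext (by simp; omega))) hne'
      · exact (key i' i j j' h hij (by omega) hx.2 hn).resolve_right hne
    · simp [hij, hn]
  rcases lt_trichotomy i j with h | h | h
  · exact step i j h hn.symm
  · rw [h, hdiag]
  · rw [hsymm, step j i h (by omega)]

lemma det_pairing_eq_zero {A ι : Type*} [CommRing A] (u : ι → Fin 3 → A) (a b : Fin 4 → ι) :
    (Matrix.of fun x y => pairing (u (a x)) (u (b y))).det = 0 := by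
  have h : (Matrix.of fun x y => pairing (u (a x)) (u (b y))) =
      (Matrix.of fun x => ![u (a x) 0, u (a x) 1, u (a x) 2, 0]) *
      (Matrix.of fun k y => ![2 * u (b y) 2, -u (b y) 1, 2 * u (b y) 0, 0] k) := by
    ext x y
    simp [Matrix.mul_apply, Fin.sum_univ_four, pairing]
    ring
  rw [h, Matrix.det_mul, Matrix.det_eq_zero_of_column_eq_zero 3 (by simp), zero_mul]

/-- The diagonal quadratic invariants and the antidiagonal sums of the off-diagonal ones. -/
def hsopElem (p : ℕ) (k : Fin (3 * p - 3)) : CoordRing p :=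
  if h : (k : ℕ) < p then quadInv ⟨k, h⟩ ⟨k, h⟩
  else ∑ x : Fin p × Fin p with x.1 < x.2 ∧ (x.1 : ℕ) + x.2 = k - p + 1, quadInv x.1 x.2

lemma hsopElem_mem_invariantRing (k : Fin (3 * p - 3)) :
    hsopElem p k ∈ invariantRing (fun _ : Fin p => 2) := by
  rw [hsopElem]
  split_ifs
  · exact quadInv_mem_invariantRing _ _
  · exact sum_mem fun x _ => quadInv_mem_invariantRing _ _

lemma isHomogeneous_hsopElem (k : Fin (3 * p - 3)) : (hsopElem p k).IsHomogeneous 2 := by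
  rw [hsopElem]
  split_ifs
  · exact isHomogeneous_quadInv _ _
  · exact IsHomogeneous.sum _ _ _ fun x _ => isHomogeneous_quadInv _ _

/-- The subalgebra generated by the chosen quadratic invariants. -/
abbrev hsopAlgebra (p : ℕ) : Subalgebra ℂ (CoordRing p) :=
  Algebra.adjoin ℂ (Set.range (hsopElem p))

lemma quadInv_self_mem_hsopAlgebra (hp : 2 ≤ p) (i : Fin p) : quadInv i i ∈ hsopAlgebra p :=
  Algebra.subset_adjoin ⟨⟨i, by omega⟩, by simp [hsopElem]⟩

lemma sum_quadInv_mem_hsopAlgebra (n : ℕ) :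
    ∑ x : Fin p × Fin p with x.1 < x.2 ∧ (x.1 : ℕ) + x.2 = n, quadInv x.1 x.2 ∈
      hsopAlgebra p := by
  by_cases hn : 1 ≤ n ∧ n + 3 ≤ 2 * p
  · refine Algebra.subset_adjoin ⟨⟨p + n - 1, by omega⟩, ?_⟩
    rw [hsopElem, dif_neg (by simp; omega)]
    congr! 4
    simp
    omega
  · rw [Finset.sum_eq_zero]
    · exact zero_mem _
    · rintro ⟨i, j⟩ hx
      simp only [Finset.mem_filter, Finset.mem_univ, true_and] at hx
      omega

lemma apply_mem_valuationSubring {K : Type*} [Field K] (V : ValuationSubring K)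
    (s : Fin p → Fin p → K) (hsymm : ∀ i j, s i j = s j i) (hdiag : ∀ i, s i i ∈ V)
    (hanti : ∀ n : ℕ,
      ∑ x : Fin p × Fin p with x.1 < x.2 ∧ (x.1 : ℕ) + x.2 = n, s x.1 x.2 ∈ V)
    (hminor : ∀ a b : Fin 4 → Fin p, (Matrix.of fun x y => s (a x) (b y)).det = 0)
    (i j : Fin p) : s i j ∈ V := by
  obtain ⟨m, -, hm⟩ := Finset.exists_max_image (Finset.univ : Finset (Fin p × Fin p))
    (fun x => V.valuation (s x.1 x.2)) ⟨(i, j), Finset.mem_univ _⟩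
  set c := s m.1 m.2
  rw [← V.valuation_le_one_iff]
  refine (hm (i, j) (Finset.mem_univ _)).trans (le_of_not_gt fun h1 => ?_)
  have hc0 : c ≠ 0 := by
    intro h0
    rw [h0, map_zero] at h1
    exact absurd h1 (by simp)
  have hle : ∀ x y, s x y / c ∈ V := fun x y => by
    rw [← V.valuation_le_one_iff, map_div₀]
    exact div_le_one_of_le₀ (hm (x, y) (Finset.mem_univ _)) zero_le
  let r : Fin p → Fin p → V := fun x y => ⟨s x y / c, hle x y⟩
  have hres : ∀ x : V, (∃ q ∈ V, (x : K) = q / c) → IsLocalRing.residue V x = 0 := by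
    rintro x ⟨q, hq, hx⟩
    rw [IsLocalRing.residue_eq_zero_iff, V.valuation_lt_one_iff, hx, map_div₀]
    rw [div_lt_one₀ (zero_lt_one.trans h1)]
    exact ((V.valuation_le_one_iff _).2 hq).trans_lt h1
  have hzero := eq_zero_of_minors_eq_zero (fun x y => IsLocalRing.residue V (r x y))
    (fun x y => by simp only [r, hsymm x y])
    (fun x => hres _ ⟨_, hdiag x, rfl⟩)
    (fun n => by
      rw [← map_sum]
      refine hres _ ⟨_, hanti n, ?_⟩
      simp [r, Finset.sum_div])
    (fun a b => by
      have : (Matrix.of fun x y => IsLocalRing.residue V (r (a x) (b y))) =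
          (IsLocalRing.residue V).mapMatrix (Matrix.of fun x y => r (a x) (b y)) := rfl
      have hdet : (Matrix.of fun x y => r (a x) (b y)).det = 0 := by
        apply Subtype.val_injective
        have h2 : V.subtype.mapMatrix (Matrix.of fun x y => r (a x) (b y)) =
            c⁻¹ • (Matrix.of fun x y => s (a x) (b y)) := by
          ext x y
          simp [r, div_eq_inv_mul]
        change V.subtype (Matrix.of fun x y => r (a x) (b y)).det = 0
        rw [RingHom.map_det, h2, Matrix.det_smul, hminor, mul_zero]
      rw [this, ← RingHom.map_det, hdet, map_zero])
    m.1 m.2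
  have hone : r m.1 m.2 = 1 := Subtype.ext (div_self hc0)
  simp [hone] at hzero

/-- Integrality over a subalgebra of a domain can be tested on valuation rings of the fraction
field. -/
lemma isIntegral_of_forall_valuationSubring {S : Type*} [CommRing S] [IsDomain S] [Algebra ℂ S]
    (A : Subalgebra ℂ S) (x : S)
    (h : ∀ V : ValuationSubring (FractionRing S),
      (∀ a ∈ A, algebraMap S (FractionRing S) a ∈ V) → algebraMap S (FractionRing S) x ∈ V) :
    IsIntegral A x := by
  let ι := algebraMap S (FractionRing S)
  have hι : Function.Injective ι := IsFractionRing.injective S (FractionRing S)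
  let B : Subring (FractionRing S) := A.toSubring.map ι
  have hB : ι x ∈ (integralClosure (Subring.closure (B : Set (FractionRing S)))
      (FractionRing S)).toSubring := by
    rw [← iInf_valuationSubring_superset, Subring.mem_iInf]
    rintro ⟨V, hV⟩
    exact h V fun a ha => hV ⟨a, ha, rfl⟩
  rw [Subring.closure_eq] at hB
  have hint : IsIntegral B (ι x) := hB
  have hA : IsIntegral A (ι x) := by
    refine hint.map_of_comp_eq
      (A.toSubring.equivMapOfInjective ι hι).symm.toRingHom (RingHom.id _) ?_
    ext b
    obtain ⟨a, rfl⟩ := (A.toSubring.equivMapOfInjective ι hι).surjective b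
    simp
    rfl
  exact (isIntegral_algebraMap_iff hι).1 hA

lemma isIntegral_quadInv (hp : 2 ≤ p) (i j : Fin p) :
    IsIntegral (hsopAlgebra p) (quadInv i j) := by
  refine isIntegral_of_forall_valuationSubring _ _ fun V hV => ?_
  refine apply_mem_valuationSubring V
    (fun i j => algebraMap (CoordRing p) (FractionRing (CoordRing p)) (quadInv i j))
    (fun i j => by rw [quadInv, pairing_comm, quadInv])
    (fun i => hV _ (quadInv_self_mem_hsopAlgebra hp i))
    (fun n => by rw [← map_sum]; exact hV _ (sum_quadInv_mem_hsopAlgebra n))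
    (fun a b => ?_) i j
  have : (Matrix.of fun x y =>
        algebraMap (CoordRing p) (FractionRing (CoordRing p)) (quadInv (a x) (b y))) =
      (algebraMap (CoordRing p) (FractionRing (CoordRing p))).mapMatrix
        (Matrix.of fun x y => pairing (coords (a x)) (coords (b y))) := rfl
  rw [this, ← RingHom.map_det, det_pairing_eq_zero, map_zero]

lemma pairing_cross_sq {A : Type*} [CommRing A] (u v w : Fin 3 → A) :
    pairing u (cross v w) ^ 2 =
      (Matrix.of ![![pairing u u, pairing u v, pairing u w],
        ![pairing v u, pairing v v, pairing v w],
        ![pairing w u, pairing w v, pairing w w]]).det := by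
  simp [Matrix.det_fin_three, pairing, cross]
  ring

lemma isIntegral_cubicInv (hp : 2 ≤ p) (i j k : Fin p) :
    IsIntegral (hsopAlgebra p) (cubicInv i j k) := by
  refine IsIntegral.of_pow two_pos ?_
  rw [cubicInv, pairing_cross_sq]
  refine IsIntegral.det fun x y => ?_
  fin_cases x <;> fin_cases y <;> exact isIntegral_quadInv hp _ _

lemma isIntegral_of_mem_invariantRing (hp : 2 ≤ p) {f : CoordRing p}
    (hf : f ∈ invariantRing (fun _ : Fin p => 2)) : IsIntegral (hsopAlgebra p) f := by
  have hle : basicInvariants p ≤ (integralClosure (hsopAlgebra p) (CoordRing p)).restrictScalars ℂ := by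
    refine Algebra.adjoin_le ?_
    rintro _ (⟨i, j, rfl⟩ | ⟨i, j, k, rfl⟩)
    · exact isIntegral_quadInv hp i j
    · exact isIntegral_cubicInv hp i j k
  rw [← basicInvariants_eq_invariantRing] at hf
  exact hle hf

lemma gram_smul {A : Type*} [CommRing A] (a b c : Fin 3 → A) :
    (pairing a a * pairing b b - pairing a b ^ 2) • c =
      (pairing c a * pairing b b - pairing c b * pairing a b) • a +
      (pairing c b * pairing a a - pairing c a * pairing a b) • b +
      pairing c (cross a b) • cross a b := by
  ext k
  fin_cases k <;> simp [pairing, cross] <;> ring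

lemma cross_apply_mem {A : Type*} [CommRing A] (L : Subring A) {a b : Fin 3 → A}
    (ha : ∀ k, a k ∈ L) (hb : ∀ k, b k ∈ L) (k : Fin 3) : cross a b k ∈ L := by
  fin_cases k
  · exact sub_mem (mul_mem (ha _) (hb _)) (mul_mem (ha _) (hb _))
  · exact mul_mem (ofNat_mem L 2) (sub_mem (mul_mem (ha _) (hb _)) (mul_mem (ha _) (hb _)))
  · exact sub_mem (mul_mem (ha _) (hb _)) (mul_mem (ha _) (hb _))

lemma apply_mem_of_pairing_mem {S : Type*} [CommRing S] [IsDomain S] [CharZero S] (L : Subring S)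
    (hpow : ∀ x : S, x ^ 2 ∈ L → x ∈ L) (hdiv : ∀ x y : S, y ≠ 0 → y ∈ L → y * x ∈ L → x ∈ L)
    {a b : Fin 3 → S} (ha0 : a 0 ∈ L) (ha2 : a 2 ∈ L) (hb1 : b 1 ∈ L) (h0 : a 0 ≠ 0)
    (h2 : a 2 ≠ 0) (haa : pairing a a ∈ L) (hab : pairing a b ∈ L) (hbb : pairing b b ∈ L) :
    (∀ k, a k ∈ L) ∧ ∀ k, b k ∈ L := by
  have two : (2 : S) ∈ L := ofNat_mem L 2
  have ha1 : a 1 ∈ L := by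
    refine hpow _ ?_
    have : a 1 ^ 2 = 2 * 2 * (a 0 * a 2) - pairing a a := by rw [pairing]; ring
    rw [this]
    exact sub_mem (mul_mem (mul_mem two two) (mul_mem ha0 ha2)) haa
  have hs : pairing a b + a 1 * b 1 ∈ L := add_mem hab (mul_mem ha1 hb1)
  have hm : 2 * (a 0 * b 2) - 2 * (a 2 * b 0) ∈ L := by
    refine hpow _ ?_
    have : (2 * (a 0 * b 2) - 2 * (a 2 * b 0)) ^ 2 =
        (pairing a b + a 1 * b 1) ^ 2 - 2 * 2 * (a 0 * a 2 * (pairing b b + b 1 ^ 2)) := by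
      rw [pairing, pairing]; ring
    rw [this]
    exact sub_mem (pow_mem hs 2) (mul_mem (mul_mem two two)
      (mul_mem (mul_mem ha0 ha2) (add_mem hbb (pow_mem hb1 2))))
  have hb2 : b 2 ∈ L := by
    refine hdiv _ (2 * 2 * a 0) (by simp [h0]) (mul_mem (mul_mem two two) ha0) ?_
    have : 2 * 2 * a 0 * b 2 =
        (pairing a b + a 1 * b 1) + (2 * (a 0 * b 2) - 2 * (a 2 * b 0)) := by rw [pairing]; ring
    rw [this]
    exact add_mem hs hm
  have hb0 : b 0 ∈ L := by
    refine hdiv _ (2 * 2 * a 2) (by simp [h2]) (mul_mem (mul_mem two two) ha2) ?_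
    have : 2 * 2 * a 2 * b 0 =
        (pairing a b + a 1 * b 1) - (2 * (a 0 * b 2) - 2 * (a 2 * b 0)) := by rw [pairing]; ring
    rw [this]
    exact sub_mem hs hm
  simp only [Fin.forall_fin_succ, Fin.forall_fin_zero]
  exact ⟨⟨ha0, ha1, ha2, trivial⟩, hb0, hb1, hb2, trivial⟩

lemma gram_ne_zero {i j : Fin p} (hij : i ≠ j) :
    quadInv i i * quadInv j j - quadInv i j ^ 2 ≠ 0 := by
  intro h
  have := congrArg (eval fun x : Idx (fun _ : Fin p => 2) =>
    if x.1 = i then (![0, 1, 0] : Fin 3 → ℂ) x.2 else ![1, 0, 1] x.2) h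
  simp [quadInv, pairing, coords, hij.symm] at this

/-- Coordinates completing the chosen quadratic invariants to a transcendence basis. -/
def extraElem (hp : 2 ≤ p) : Fin 3 → CoordRing p :=
  ![coords ⟨0, by omega⟩ 0, coords ⟨0, by omega⟩ 2, coords ⟨1, by omega⟩ 1]

/-- The algebra generated by the quadratic invariants and the extra coordinates. -/
abbrev extAlgebra (hp : 2 ≤ p) : Subalgebra ℂ (CoordRing p) :=
  Algebra.adjoin ℂ (Set.range (Sum.elim (hsopElem p) (extraElem hp)))

lemma isAlgebraic_of_mem_invariantRing (hp : 2 ≤ p) {f : CoordRing p}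
    (hf : f ∈ invariantRing (fun _ : Fin p => 2)) : IsAlgebraic (extAlgebra hp) f := by
  have hle : hsopAlgebra p ≤ extAlgebra hp :=
    Algebra.adjoin_mono (by rw [Set.Sum.elim_range]; exact Set.subset_union_left)
  have h := (isIntegral_of_mem_invariantRing hp hf).map_of_comp_eq
    (T := extAlgebra hp) (Subalgebra.inclusion hle).toRingHom (RingHom.id _) rfl
  exact h.isAlgebraic

lemma isAlgebraic_coords (hp : 2 ≤ p) (j : Fin p) (k : Fin 3) :
    IsAlgebraic (extAlgebra hp) (coords j k) := by
  let L : Subring (CoordRing p) :=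
    (Subalgebra.algebraicClosure (extAlgebra hp) (CoordRing p)).toSubring
  have hinv : ∀ f ∈ invariantRing (fun _ : Fin p => 2), f ∈ L :=
    fun f hf => isAlgebraic_of_mem_invariantRing hp hf
  have hq : ∀ i j : Fin p, quadInv i j ∈ L := fun i j => hinv _ (quadInv_mem_invariantRing i j)
  have hextra : ∀ l, extraElem hp l ∈ L := fun l =>
    isAlgebraic_algebraMap (⟨_, Algebra.subset_adjoin ⟨.inr l, rfl⟩⟩ : extAlgebra hp)
  have hdiv : ∀ x y : CoordRing p, y ≠ 0 → y ∈ L → y * x ∈ L → x ∈ L := fun x y hy h1 h2 =>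
    IsAlgebraic.of_mul (mem_nonZeroDivisors_of_ne_zero hy) h1 h2
  obtain ⟨ha, hb⟩ := apply_mem_of_pairing_mem L (fun x hx => IsAlgebraic.of_pow two_pos hx) hdiv
    (a := coords ⟨0, by omega⟩) (b := coords ⟨1, by omega⟩) (hextra 0) (hextra 1) (hextra 2)
    (X_ne_zero _) (X_ne_zero _) (hq _ _) (hq _ _) (hq _ _)
  refine hdiv _ _ (gram_ne_zero (i := ⟨0, by omega⟩) (j := ⟨1, by omega⟩) (by simp))
    (sub_mem (mul_mem (hq _ _) (hq _ _)) (pow_mem (hq _ _) 2)) ?_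
  have h := congrFun (gram_smul (coords ⟨0, by omega⟩) (coords ⟨1, by omega⟩) (coords j)) k
  rw [Pi.smul_apply, smul_eq_mul] at h
  rw [quadInv, quadInv, quadInv, h]
  refine add_mem (add_mem (mul_mem (sub_mem ?_ ?_) (ha k)) (mul_mem (sub_mem ?_ ?_) (hb k)))
    (mul_mem (hinv _ (cubicInv_mem_invariantRing j _ _)) (cross_apply_mem L ha hb k)) <;>
  exact mul_mem (hq _ _) (hq _ _)

lemma algebraicIndependent_hsopElem (hp : 2 ≤ p) : AlgebraicIndependent ℂ (hsopElem p) := by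
  have : Algebra.IsAlgebraic (extAlgebra hp) (CoordRing p) := ⟨fun f => by
    change f ∈ Subalgebra.algebraicClosure (extAlgebra hp) (CoordRing p)
    induction f using MvPolynomial.induction_on with
    | C a => exact isAlgebraic_algebraMap (algebraMap ℂ (extAlgebra hp) a)
    | add f g hf hg => exact add_mem hf hg
    | mul_X f i hf => exact mul_mem hf (isAlgebraic_coords hp i.1 i.2)⟩
  have hb := Algebra.IsAlgebraic.isTranscendenceBasis_of_le_trdeg_of_finite ℂ
    (Sum.elim (hsopElem p) (extraElem hp)) (by
      rw [MvPolynomial.trdeg_of_isDomain]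
      simp [Idx]
      norm_cast
      omega)
  exact hb.1.comp Sum.inl Sum.inl_injective

lemma cubicInv_swap_left (i j k : Fin p) : cubicInv i j k = -cubicInv j i k := by
  simp [cubicInv, pairing, cross]
  ring

lemma cubicInv_swap_right (i j k : Fin p) : cubicInv i j k = -cubicInv i k j := by
  simp [cubicInv, pairing, cross]
  ring

lemma cubicInv_self_left (i j : Fin p) : cubicInv i i j = 0 := by
  simp [cubicInv, pairing, cross]
  ring

lemma cubicInv_self_right (i j : Fin p) : cubicInv i j j = 0 := by
  simp [cubicInv, pairing, cross]
  ring

lemma cubicInv_mem_of_lt {L : Subalgebra ℂ (CoordRing p)}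
    (h : ∀ i j k : Fin p, i < j → j < k → cubicInv i j k ∈ L) (i j k : Fin p) :
    cubicInv i j k ∈ L := by
  have h1 : ∀ i j k : Fin p, i < j → cubicInv i j k ∈ L := by
    intro i j k hij
    rcases lt_trichotomy j k with hjk | rfl | hjk
    · exact h i j k hij hjk
    · rw [cubicInv_self_right]; exact zero_mem _
    · rw [cubicInv_swap_right]
      rcases lt_trichotomy i k with hik | rfl | hik
      · exact neg_mem (h i k j hik hjk)
      · rw [cubicInv_self_left]; exact neg_mem (zero_mem _)
      · rw [cubicInv_swap_left]; exact neg_mem (neg_mem (h k i j hik hij))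
  rcases lt_trichotomy i j with hij | rfl | hij
  · exact h1 i j k hij
  · rw [cubicInv_self_left]; exact zero_mem _
  · rw [cubicInv_swap_left]; exact neg_mem (h1 j i k hij)

lemma mem_adjoin_of_smul_mem {S : Type*} [CommRing S] [Algebra ℂ S] {s : Set S} {c : ℂ}
    (hc : c ≠ 0) {x : S} (h : c • x ∈ s) : x ∈ Algebra.adjoin ℂ s :=
  ((Algebra.adjoin ℂ s).toSubmodule.smul_mem_iff hc).1 (Algebra.subset_adjoin h)

end

end BinInv

open BinInv in
/-- For `V = p·V₂` (`p ≥ 2`), the invariant ring is generated by the degree-2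
invariants `(qᵢ,qⱼ)₂` for `i ≤ j` together with the degree-3 invariants
`(qᵢ,(qⱼ,q_k)₁)₂` for `i < j < k`, and it has a homogeneous system of parameters
consisting of `3p − 3` invariants of degree 2. -/
theorem pV2_generators_and_hsop (p : ℕ) (hp : 2 ≤ p) :
    Algebra.adjoin ℂ
        {P : MvPolynomial (Idx (fun _ : Fin p => 2)) ℂ |
          (∃ i j : Fin p, i ≤ j ∧
            P = constantCoeff
              (transvectant 2 2 2 (genForm (fun _ => 2) i) (genForm (fun _ => 2) j))) ∨
          (∃ i j k : Fin p, i < j ∧ j < k ∧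
            P = constantCoeff
              (transvectant 2 2 2 (genForm (fun _ => 2) i)
                (transvectant 2 2 1 (genForm (fun _ => 2) j) (genForm (fun _ => 2) k))))} =
      invariantRing (fun _ : Fin p => 2) ∧
    ∃ Q : Fin (3 * p - 3) → MvPolynomial (Idx (fun _ : Fin p => 2)) ℂ,
      IsHSOP (fun _ : Fin p => 2) Q (fun _ => 2) := by
  refine ⟨?_, hsopElem p, hsopElem_mem_invariantRing, fun _ => two_pos, isHomogeneous_hsopElem,
    algebraicIndependent_hsopElem hp, fun x hx => isIntegral_of_mem_invariantRing hp hx⟩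
  simp only [constantCoeff_transvectant_genForm, constantCoeff_transvectant_transvectant_genForm]
  apply le_antisymm
  · refine Algebra.adjoin_le ?_
    rintro _ (⟨i, j, -, rfl⟩ | ⟨i, j, k, -, -, rfl⟩)
    · exact Subalgebra.smul_mem _ (quadInv_mem_invariantRing i j) _
    · exact Subalgebra.smul_mem _ (cubicInv_mem_invariantRing i j k) _
  · rw [← basicInvariants_eq_invariantRing]
    refine Algebra.adjoin_le ?_
    have hquad : ∀ i j : Fin p, i ≤ j → quadInv i j ∈ Algebra.adjoin ℂ
        {P | (∃ i j : Fin p, i ≤ j ∧ P = (2⁻¹ : ℂ) • quadInv i j) ∨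
          (∃ i j k : Fin p, i < j ∧ j < k ∧ P = (4⁻¹ : ℂ) • cubicInv i j k)} := fun i j hij =>
      mem_adjoin_of_smul_mem (by norm_num) (Or.inl ⟨i, j, hij, rfl⟩)
    rintro _ (⟨i, j, rfl⟩ | ⟨i, j, k, rfl⟩)
    · rcases le_total i j with h | h
      · exact hquad i j h
      · rw [quadInv, pairing_comm]
        exact hquad j i h
    · exact cubicInv_mem_of_lt (fun i j k hij hjk =>
        mem_adjoin_of_smul_mem (by norm_num) (Or.inr ⟨i, j, k, hij, hjk, rfl⟩)) i j k
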